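/- Let M : ℝˡ × ℝⁿ ⇒ ℝᵐ have closed graph, 0 ∈ M(p̄,x̄), and S(p) := {x : 0 ∈ M(p,x)}. Assume: (a) {u : 0 ∈ DM(p̄,x̄,0)(q,u)} ≠ ∅ for all q ∈ ℝˡ; (b) M is metrically subregular at ((p̄,x̄), 0); and (c) for every (q,u) ≠ (0,0) with 0 ∈ DM(p̄,x̄,0)(q,u), the condition (q*, 0) ∈ D*M((p̄,x̄,0); (q,u,0))(v*) implies q* = 0. Then S has the Aubin property around (p̄, x̄), and its graphical derivative is DS(p̄,x̄)(q) = {u : 0 ∈ DM(p̄,x̄,0)(q,u)} for all q ∈ ℝˡ. -/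

import Mathlib

open Filter Topology Metric Set
open scoped RealInnerProductSpace

noncomputable section

abbrev Es (k : ℕ) : Type := EuclideanSpace ℝ (Fin k)

/-- The tangent (contingent) cone to `A` at `x`. -/
def tcone {E : Type*} [NormedAddCommGroup E] [NormedSpace ℝ E] (A : Set E) (x : E) : Set E :=
  {w | ∃ t : ℕ → ℝ, ∃ w' : ℕ → E,
    (∀ k, 0 < t k) ∧ Tendsto t atTop (𝓝 0) ∧ Tendsto w' atTop (𝓝 w) ∧
    ∀ k, x + t k • w' k ∈ A}

/-- Graph of a multifunction of two variables, as a subset of a triple product. -/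
def gph3 {P X Y : Type*} (M : P × X → Set Y) : Set (P × X × Y) :=
  {z | z.2.2 ∈ M (z.1, z.2.1)}

/-- The canonical pairing on a triple product of real inner product spaces. -/
def pr3 {P X Y : Type*} [NormedAddCommGroup P] [InnerProductSpace ℝ P]
    [NormedAddCommGroup X] [InnerProductSpace ℝ X]
    [NormedAddCommGroup Y] [InnerProductSpace ℝ Y] (a b : P × X × Y) : ℝ :=
  ⟪a.1, b.1⟫ + ⟪a.2.1, b.2.1⟫ + ⟪a.2.2, b.2.2⟫

/-- The regular (Fréchet) normal cone to `A ⊆ P × X × Y` at `z`; it is empty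
(by convention) when `z ∉ A`. -/
def rnc3 {P X Y : Type*} [NormedAddCommGroup P] [InnerProductSpace ℝ P]
    [NormedAddCommGroup X] [InnerProductSpace ℝ X]
    [NormedAddCommGroup Y] [InnerProductSpace ℝ Y]
    (A : Set (P × X × Y)) (z : P × X × Y) : Set (P × X × Y) :=
  {zs | z ∈ A ∧ ∀ w ∈ tcone A z, pr3 zs w ≤ 0}

/-- The directional limiting normal cone to `A ⊆ P × X × Y` at `z` in direction `w`. -/
def dnc3 {P X Y : Type*} [NormedAddCommGroup P] [InnerProductSpace ℝ P]
    [NormedAddCommGroup X] [InnerProductSpace ℝ X]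
    [NormedAddCommGroup Y] [InnerProductSpace ℝ Y]
    (A : Set (P × X × Y)) (z w : P × X × Y) : Set (P × X × Y) :=
  {zs | ∃ t : ℕ → ℝ, ∃ w' : ℕ → P × X × Y, ∃ zs' : ℕ → P × X × Y,
    (∀ k, 0 < t k) ∧ Tendsto t atTop (𝓝 0) ∧ Tendsto w' atTop (𝓝 w) ∧
    Tendsto zs' atTop (𝓝 zs) ∧ ∀ k, zs' k ∈ rnc3 A (z + t k • w' k)}

/-- `F` has the Aubin (Lipschitz-like) property around `(pb, xb) ∈ gph F` (with the
convention that the distance to the empty set is `+∞`). -/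
def AubinAround {P X : Type*} [MetricSpace P] [MetricSpace X] (F : P → Set X) (pb : P)
    (xb : X) : Prop :=
  ∃ κ : ℝ, 0 ≤ κ ∧ ∃ ε : ℝ, 0 < ε ∧ ∀ p p' x, dist p pb < ε → dist x xb < ε → x ∈ F p' →
    EMetric.infEdist x (F p) ≤ ENNReal.ofReal (κ * dist p' p)

/-- A `C^{1,1}` regularization of the norm. -/
def smoothNorm {E : Type*} [NormedAddCommGroup E] (δ : ℝ) (y : E) : ℝ :=
  √(‖y‖ ^ 2 + δ ^ 2)

section SmoothNorm

variable {E : Type*} [NormedAddCommGroup E]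

lemma smoothNorm_pos {δ : ℝ} (hδ : 0 < δ) (y : E) : 0 < smoothNorm δ y :=
  Real.sqrt_pos.2 (by positivity)

lemma norm_le_smoothNorm (δ : ℝ) (y : E) : ‖y‖ ≤ smoothNorm δ y :=
  Real.le_sqrt_of_sq_le (by nlinarith [sq_nonneg δ])

lemma smoothNorm_le {δ : ℝ} (hδ : 0 ≤ δ) (y : E) : smoothNorm δ y ≤ ‖y‖ + δ :=
  Real.sqrt_le_iff.2 ⟨by positivity, by nlinarith [mul_nonneg (norm_nonneg y) hδ]⟩

lemma continuous_smoothNorm (δ : ℝ) : Continuous (smoothNorm δ : E → ℝ) := by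
  unfold smoothNorm
  fun_prop

lemma smoothNorm_add_le [InnerProductSpace ℝ E] {δ : ℝ} (hδ : 0 < δ) (y d : E) :
    smoothNorm δ (y + d) ≤
      smoothNorm δ y + ⟪(smoothNorm δ y)⁻¹ • y, d⟫ + (2 * δ)⁻¹ * ‖d‖ ^ 2 := by
  have hs := smoothNorm_pos hδ y
  have hs2 : smoothNorm δ y ^ 2 = ‖y‖ ^ 2 + δ ^ 2 := Real.sq_sqrt (by positivity)
  have hs2' : smoothNorm δ (y + d) ^ 2 = ‖y + d‖ ^ 2 + δ ^ 2 := Real.sq_sqrt (by positivity)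
  have hδs : δ ≤ smoothNorm δ y := Real.le_sqrt_of_sq_le (by nlinarith [sq_nonneg ‖y‖])
  rw [norm_add_sq_real] at hs2'
  set s := smoothNorm δ y
  set s' := smoothNorm δ (y + d)
  have h1 : s' ≤ s + s⁻¹ * ⟪y, d⟫ + (2 * s)⁻¹ * ‖d‖ ^ 2 := by
    have : s + s⁻¹ * ⟪y, d⟫ + (2 * s)⁻¹ * ‖d‖ ^ 2 - s' = (s' - s) ^ 2 / (2 * s) := by
      field_simp
      nlinarith
    have h2 : 0 ≤ (s' - s) ^ 2 / (2 * s) := by positivity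
    linarith
  have h3 : (2 * s)⁻¹ * ‖d‖ ^ 2 ≤ (2 * δ)⁻¹ * ‖d‖ ^ 2 := by gcongr
  rw [real_inner_smul_left]
  linarith

lemma norm_inv_smoothNorm_smul_le [NormedSpace ℝ E] {δ : ℝ} (hδ : 0 < δ) (y : E) :
    ‖(smoothNorm δ y)⁻¹ • y‖ ≤ 1 := by
  have hs := smoothNorm_pos hδ y
  rw [norm_smul, norm_inv, Real.norm_of_nonneg hs.le, inv_mul_le_iff₀ hs, mul_one]
  exact norm_le_smoothNorm δ y

lemma half_le_norm_inv_smoothNorm_smul [NormedSpace ℝ E] {δ : ℝ} (hδ : 0 < δ) {y : E}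
    (hy : δ ≤ ‖y‖) : 1 / 2 ≤ ‖(smoothNorm δ y)⁻¹ • y‖ := by
  have hs := smoothNorm_pos hδ y
  rw [norm_smul, norm_inv, Real.norm_of_nonneg hs.le, ← div_eq_inv_mul, le_div_iff₀ hs]
  linarith [smoothNorm_le hδ.le y]

lemma norm_add_sq_eq_sub [InnerProductSpace ℝ E] (y y₀ d : E) :
    ‖y + d - y₀‖ ^ 2 = ‖y - y₀‖ ^ 2 + ⟪(2 : ℝ) • (y - y₀), d⟫ + ‖d‖ ^ 2 := by
  rw [add_sub_right_comm, norm_add_sq_real, real_inner_smul_left]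

end SmoothNorm

section Triple

variable {P X Y : Type*} [NormedAddCommGroup P] [InnerProductSpace ℝ P]
  [NormedAddCommGroup X] [InnerProductSpace ℝ X]
  [NormedAddCommGroup Y] [InnerProductSpace ℝ Y]

/-- First-order optimality: at a local minimizer over `A`, the negative gradient is a regular
normal. -/
lemma neg_mem_rnc3_of_isLocalMin {A : Set (P × X × Y)} {z g : P × X × Y} (hz : z ∈ A)
    {φ : P × X × Y → ℝ} {C : ℝ} (hφ : ∀ d, φ (z + d) ≤ φ z + pr3 g d + C * ‖d‖ ^ 2)
    (hmin : ∀ᶠ y in 𝓝 z, y ∈ A → φ z ≤ φ y) : -g ∈ rnc3 A z := by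
  refine ⟨hz, ?_⟩
  rintro w ⟨t, w', ht, ht0, hw', hA⟩
  have hlim : Tendsto (fun k => z + t k • w' k) atTop (𝓝 z) := by
    simpa using tendsto_const_nhds.add (ht0.smul hw')
  have hpr : Continuous (fun d : P × X × Y => pr3 g d) := by
    unfold pr3
    fun_prop
  have h1 : Tendsto (fun k => pr3 g (w' k) + C * (t k * ‖w' k‖ ^ 2)) atTop
      (𝓝 (pr3 g w + C * (0 * ‖w‖ ^ 2))) :=
    ((hpr.tendsto w).comp hw').add ((ht0.mul (hw'.norm.pow 2)).const_mul C)
  have h2 : 0 ≤ pr3 g w + C * (0 * ‖w‖ ^ 2) := by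
    refine ge_of_tendsto h1 ?_
    filter_upwards [hlim.eventually hmin] with k hk
    have h3 := (hk (hA k)).trans (hφ _)
    have h4 : pr3 g (t k • w' k) = t k * pr3 g (w' k) := by
      simp only [pr3, Prod.smul_fst, Prod.smul_snd, real_inner_smul_right]
      ring
    rw [h4, norm_smul, Real.norm_of_nonneg (ht k).le] at h3
    have h5 : 0 ≤ t k * (pr3 g (w' k) + C * (t k * ‖w' k‖ ^ 2)) := by linarith
    exact nonneg_of_mul_nonneg_right h5 (ht k)
  have h6 : pr3 (-g) w = - pr3 g w := by
    simp only [pr3, Prod.fst_neg, Prod.snd_neg, inner_neg_left]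
    ring
  rw [h6]
  linarith

/-- Fuzzy optimality condition for a penalized sum of norms over a closed set. -/
lemma exists_rnc3_of_local_min_norms [ProperSpace P] [ProperSpace X] [ProperSpace Y]
    {A : Set (P × X × Y)} (hA : IsClosed A) {p₀ a : P} {x₀ b : X}
    (hz₀ : (p₀, x₀, (0 : Y)) ∈ A) (hne : p₀ ≠ a) {α K ρ : ℝ} (hα : 0 ≤ α) (hK : 0 ≤ K)
    (hρ : 0 < ρ)
    (hmin : ∀ z ∈ A, dist z (p₀, x₀, (0 : Y)) < ρ →
      ‖p₀ - a‖ + α * ‖x₀ - b‖ ≤ ‖z.1 - a‖ + α * ‖z.2.1 - b‖ + K * ‖z.2.2‖)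
    {r : ℝ} (hr : 0 < r) :
    ∃ z, dist z (p₀, x₀, (0 : Y)) < r ∧ ∃ zs ∈ rnc3 A z,
      1 / 4 ≤ ‖zs.1‖ ∧ ‖zs.1‖ ≤ 2 ∧ ‖zs.2.1‖ ≤ α + r ∧ ‖zs.2.2‖ ≤ K + r := by
  have hγ : 0 < ‖p₀ - a‖ := norm_pos_iff.2 (sub_ne_zero.2 hne)
  obtain ⟨R, hR0, hRr, hRρ, hR8, hRγ⟩ : ∃ R : ℝ, 0 < R ∧ 2 * R ≤ r ∧ R < ρ ∧ R ≤ 1 / 8 ∧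
      R ≤ ‖p₀ - a‖ / 2 := by
    refine ⟨min (min (r / 2) (ρ / 2)) (min (1 / 8) (‖p₀ - a‖ / 2)), by positivity, ?_, ?_, ?_, ?_⟩
    · linarith [min_le_left (min (r / 2) (ρ / 2)) (min (1 / 8) (‖p₀ - a‖ / 2)),
        min_le_left (r / 2) (ρ / 2)]
    · linarith [min_le_left (min (r / 2) (ρ / 2)) (min (1 / 8) (‖p₀ - a‖ / 2)),
        min_le_right (r / 2) (ρ / 2)]
    · exact (min_le_right _ _).trans (min_le_left _ _)
    · exact (min_le_right _ _).trans (min_le_right _ _)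
  obtain ⟨δ, hδ0, hδγ, hδR⟩ : ∃ δ : ℝ, 0 < δ ∧ δ ≤ ‖p₀ - a‖ / 2 ∧ (1 + α + K) * δ < R ^ 2 := by
    have hc : 0 < 1 + α + K := by positivity
    refine ⟨min (‖p₀ - a‖ / 2) (R ^ 2 / (2 * (1 + α + K))), by positivity, min_le_left _ _, ?_⟩
    calc (1 + α + K) * min (‖p₀ - a‖ / 2) (R ^ 2 / (2 * (1 + α + K)))
        ≤ (1 + α + K) * (R ^ 2 / (2 * (1 + α + K))) := by gcongr; exact min_le_right _ _
      _ = R ^ 2 / 2 := by field_simp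
      _ < R ^ 2 := by linarith [pow_pos hR0 2]
  set z₀ : P × X × Y := (p₀, x₀, 0) with hz₀_def
  set φ : P × X × Y → ℝ := fun z =>
    smoothNorm δ (z.1 - a) + α * smoothNorm δ (z.2.1 - b) + K * smoothNorm δ z.2.2 +
      (‖z.1 - p₀‖ ^ 2 + ‖z.2.1 - x₀‖ ^ 2 + ‖z.2.2 - 0‖ ^ 2) with hφ
  have hcont : Continuous φ := by
    have h1 := continuous_smoothNorm (E := P) δ
    have h2 := continuous_smoothNorm (E := X) δ
    have h3 := continuous_smoothNorm (E := Y) δ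
    fun_prop
  obtain ⟨z, ⟨hzA, hzR⟩, hzmin⟩ := ((isCompact_closedBall z₀ R).inter_left hA).exists_isMinOn
    ⟨z₀, hz₀, mem_closedBall_self hR0.le⟩ hcont.continuousOn
  have hzmin' : ∀ y ∈ A, dist y z₀ ≤ R → φ z ≤ φ y := fun y hy hyR => hzmin ⟨hy, hyR⟩
  have hzR' : dist z z₀ ≤ R := hzR
  have hsq : ‖z.1 - p₀‖ ^ 2 + ‖z.2.1 - x₀‖ ^ 2 + ‖z.2.2 - 0‖ ^ 2 < R ^ 2 := by
    have h1 := hzmin' z₀ hz₀ (by simpa using hR0.le)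
    have h2 := hmin z hzA (hzR'.trans_lt hRρ)
    simp only [hφ, hz₀_def, sub_self, norm_zero] at h1
    have h3 := smoothNorm_le hδ0.le (p₀ - a)
    have h4 := mul_le_mul_of_nonneg_left (smoothNorm_le hδ0.le (x₀ - b)) hα
    have h5 := mul_le_mul_of_nonneg_left (smoothNorm_le hδ0.le (0 : Y)) hK
    have h6 := norm_le_smoothNorm δ (z.1 - a)
    have h7 := mul_le_mul_of_nonneg_left (norm_le_smoothNorm δ (z.2.1 - b)) hα
    have h8 := mul_le_mul_of_nonneg_left (norm_le_smoothNorm δ z.2.2) hK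
    rw [norm_zero] at h5
    linarith
  have hn1 : ‖z.1 - p₀‖ < R := by
    refine lt_of_pow_lt_pow_left₀ 2 hR0.le ?_
    linarith [sq_nonneg ‖z.2.1 - x₀‖, sq_nonneg ‖z.2.2 - 0‖]
  have hn2 : ‖z.2.1 - x₀‖ < R := by
    refine lt_of_pow_lt_pow_left₀ 2 hR0.le ?_
    linarith [sq_nonneg ‖z.1 - p₀‖, sq_nonneg ‖z.2.2 - 0‖]
  have hn3 : ‖z.2.2 - 0‖ < R := by
    refine lt_of_pow_lt_pow_left₀ 2 hR0.le ?_
    linarith [sq_nonneg ‖z.1 - p₀‖, sq_nonneg ‖z.2.1 - x₀‖]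
  have hdist : dist z z₀ < R := by
    simp only [hz₀_def, dist_eq_norm]
    exact max_lt hn1 (max_lt hn2 hn3)
  set g : P × X × Y :=
    ((smoothNorm δ (z.1 - a))⁻¹ • (z.1 - a) + (2 : ℝ) • (z.1 - p₀),
      α • (smoothNorm δ (z.2.1 - b))⁻¹ • (z.2.1 - b) + (2 : ℝ) • (z.2.1 - x₀),
      K • (smoothNorm δ z.2.2)⁻¹ • z.2.2 + (2 : ℝ) • (z.2.2 - 0)) with hg
  have hexp : ∀ d, φ (z + d) ≤ φ z + pr3 g d + ((1 + α + K) * (2 * δ)⁻¹ + 3) * ‖d‖ ^ 2 := by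
    intro d
    have e1 : ‖d.1‖ ≤ ‖d‖ := norm_fst_le d
    have e2 : ‖d.2.1‖ ≤ ‖d‖ := (norm_fst_le d.2).trans (norm_snd_le d)
    have e3 : ‖d.2.2‖ ≤ ‖d‖ := (norm_snd_le d.2).trans (norm_snd_le d)
    have q1 : ‖d.1‖ ^ 2 ≤ ‖d‖ ^ 2 := by gcongr
    have q2 : ‖d.2.1‖ ^ 2 ≤ ‖d‖ ^ 2 := by gcongr
    have q3 : ‖d.2.2‖ ^ 2 ≤ ‖d‖ ^ 2 := by gcongr
    have hi : 0 ≤ (2 * δ)⁻¹ := by positivity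
    have s1 := smoothNorm_add_le hδ0 (z.1 - a) d.1
    have s2 := mul_le_mul_of_nonneg_left (smoothNorm_add_le hδ0 (z.2.1 - b) d.2.1) hα
    have s3 := mul_le_mul_of_nonneg_left (smoothNorm_add_le hδ0 z.2.2 d.2.2) hK
    rw [sub_add_eq_add_sub] at s1 s2
    have r1 := mul_le_mul_of_nonneg_left q1 hi
    have r2 := mul_le_mul_of_nonneg_left (mul_le_mul_of_nonneg_left q2 hi) hα
    have r3 := mul_le_mul_of_nonneg_left (mul_le_mul_of_nonneg_left q3 hi) hK
    simp only [hφ, hg, pr3, Prod.fst_add, Prod.snd_add, norm_add_sq_eq_sub, inner_add_left,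
      real_inner_smul_left _ _ α, real_inner_smul_left _ _ K]
    linarith
  refine ⟨z, hdist.trans_le (by linarith), -g,
    neg_mem_rnc3_of_isLocalMin hzA hexp ?_, ?_, ?_, ?_, ?_⟩
  · filter_upwards [isOpen_ball.mem_nhds (mem_ball.2 hdist)] with y hy hyA
    exact hzmin' y hyA (mem_ball.1 hy).le
  · have h1 : δ ≤ ‖z.1 - a‖ := by
      have h2 : ‖p₀ - a‖ ≤ ‖z.1 - a‖ + ‖z.1 - p₀‖ := by
        have := norm_sub_le (z.1 - a) (z.1 - p₀)
        rwa [sub_sub_sub_cancel_left] at this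
      linarith
    have h3 := half_le_norm_inv_smoothNorm_smul hδ0 h1
    have h4 := norm_sub_le_norm_add ((smoothNorm δ (z.1 - a))⁻¹ • (z.1 - a))
      ((2 : ℝ) • (z.1 - p₀))
    rw [norm_smul (2 : ℝ), Real.norm_of_nonneg zero_le_two] at h4
    rw [Prod.fst_neg, norm_neg]
    linarith
  · rw [Prod.fst_neg, norm_neg]
    refine (norm_add_le _ _).trans ?_
    rw [norm_smul (2 : ℝ), Real.norm_of_nonneg zero_le_two]
    linarith [norm_inv_smoothNorm_smul_le hδ0 (z.1 - a)]
  · rw [Prod.snd_neg, Prod.fst_neg, norm_neg]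
    refine (norm_add_le _ _).trans ?_
    rw [norm_smul (2 : ℝ), norm_smul α, Real.norm_of_nonneg zero_le_two, Real.norm_of_nonneg hα]
    linarith [mul_le_mul_of_nonneg_left (norm_inv_smoothNorm_smul_le hδ0 (z.2.1 - b)) hα]
  · rw [Prod.snd_neg, Prod.snd_neg, norm_neg]
    refine (norm_add_le _ _).trans ?_
    rw [norm_smul (2 : ℝ), norm_smul K, Real.norm_of_nonneg zero_le_two, Real.norm_of_nonneg hK]
    linarith [mul_le_mul_of_nonneg_left (norm_inv_smoothNorm_smul_le hδ0 z.2.2) hK]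

lemma fst_mem_tcone_of_subregular {M : P × X → Set Y} {z₀ : P × X} {κ ε : ℝ} (hε : 0 < ε)
    (hsub : ∀ z, dist z z₀ < ε → ∀ v ∈ M z, ∀ η > 0,
      ∃ ζ, (0 : Y) ∈ M ζ ∧ dist z ζ < κ * ‖v‖ + η)
    {q : P} {u : X} (h : (q, u, (0 : Y)) ∈ tcone (gph3 M) (z₀.1, z₀.2, (0 : Y))) :
    (q, u) ∈ tcone {z | (0 : Y) ∈ M z} z₀ := by
  obtain ⟨t, w, ht, ht0, hw, hA⟩ := h
  have hwq : Tendsto (fun k => ((w k).1, (w k).2.1)) atTop (𝓝 (q, u)) :=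
    ((continuous_fst.prodMk (continuous_fst.comp continuous_snd)).tendsto _).comp hw
  have hwv : Tendsto (fun k => (w k).2.2) atTop (𝓝 0) :=
    ((continuous_snd.comp continuous_snd).tendsto _).comp hw
  have hlim : Tendsto (fun k => z₀ + t k • ((w k).1, (w k).2.1)) atTop (𝓝 z₀) := by
    simpa using tendsto_const_nhds.add (ht0.smul hwq)
  obtain ⟨N, hN⟩ := eventually_atTop.1 (hlim.eventually (ball_mem_nhds z₀ hε))
  have hN' : ∀ k, ∃ ζ, (0 : Y) ∈ M ζ ∧ dist (z₀ + t (k + N) • ((w (k + N)).1, (w (k + N)).2.1)) ζ <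
      κ * ‖t (k + N) • (w (k + N)).2.2‖ + t (k + N) * (1 / ((k : ℝ) + 1)) := by
    intro k
    refine hsub _ (hN _ (Nat.le_add_left _ _)) _ ?_ _ (mul_pos (ht _) (by positivity))
    have h := hA (k + N)
    simp only [gph3, mem_ofPred_eq, Prod.snd_add, Prod.smul_snd, zero_add] at h
    exact h
  choose ζ hζ hdist using hN'
  have hshift : Tendsto (fun k => k + N) atTop atTop := tendsto_add_atTop_nat N
  refine ⟨fun k => t (k + N), fun k => (t (k + N))⁻¹ • (ζ k - z₀), fun k => ht _,
    ht0.comp hshift, ?_, fun k => ?_⟩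
  · refine tendsto_of_tendsto_of_dist (hwq.comp hshift) ?_
    have hb : Tendsto (fun k : ℕ => κ * ‖(w (k + N)).2.2‖ + 1 / ((k : ℝ) + 1)) atTop (𝓝 0) := by
      simpa using ((hwv.comp hshift).norm.const_mul κ).add tendsto_one_div_add_atTop_nhds_zero_nat
    refine squeeze_zero (fun _ => dist_nonneg) (fun k => ?_) hb
    have h1 := (hdist k).le
    have htk := ht (k + N)
    rw [dist_eq_norm, norm_smul, Real.norm_of_nonneg htk.le] at h1
    simp only [Function.comp_apply]
    rw [dist_eq_norm]
    refine le_of_mul_le_mul_left ?_ htk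
    calc t (k + N) * ‖((w (k + N)).1, (w (k + N)).2.1) - (t (k + N))⁻¹ • (ζ k - z₀)‖
        = ‖z₀ + t (k + N) • ((w (k + N)).1, (w (k + N)).2.1) - ζ k‖ := by
          conv_lhs => rw [← Real.norm_of_nonneg htk.le, ← norm_smul, smul_sub,
            Real.norm_of_nonneg htk.le, smul_inv_smul₀ htk.ne']
          congr 1
          abel
      _ ≤ _ := by linarith
  · simp only [smul_inv_smul₀ (ht (k + N)).ne', add_sub_cancel]
    exact hζ k

lemma tcone_fst_subset {M : P × X → Set Y} {z₀ : P × X} {q : P} {u : X}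
    (h : (q, u) ∈ tcone {z | (0 : Y) ∈ M z} z₀) :
    (q, u, (0 : Y)) ∈ tcone (gph3 M) (z₀.1, z₀.2, (0 : Y)) := by
  obtain ⟨t, w, ht, ht0, hw, hA⟩ := h
  refine ⟨t, fun k => ((w k).1, (w k).2, 0), ht, ht0, ?_, fun k => ?_⟩
  · exact ((continuous_fst.prodMk (continuous_snd.prodMk continuous_const)).tendsto (q, u)).comp hw
  · simp only [gph3, mem_ofPred_eq, Prod.snd_add, Prod.smul_snd, smul_zero, add_zero]
    exact hA k

/-- Tangential first-order condition at a minimizer of `‖· - a‖ + α ‖· - b‖`. -/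
lemma neg_mul_norm_le_inner_of_min {Γ : Set (P × X)} {z₀ : P × X} {a : P} {b : X} {α : ℝ}
    (hα : 0 ≤ α)
    (hmin : ∀ z ∈ Γ, ‖z₀.1 - a‖ + α * ‖z₀.2 - b‖ ≤ ‖z.1 - a‖ + α * ‖z.2 - b‖)
    {q : P} {u : X} (h : (q, u) ∈ tcone Γ z₀) :
    -(α * ‖u‖ * ‖z₀.1 - a‖) ≤ ⟪z₀.1 - a, q⟫ := by
  obtain ⟨t, w, ht, ht0, hw, hA⟩ := h
  have hw1 : Tendsto (fun k => (w k).1) atTop (𝓝 q) := (continuous_fst.tendsto _).comp hw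
  have hw2 : Tendsto (fun k => (w k).2) atTop (𝓝 u) := (continuous_snd.tendsto _).comp hw
  have h1 : Tendsto (fun k => 2 * (α * ‖(w k).2‖ * ‖z₀.1 - a‖) + 2 * ⟪z₀.1 - a, (w k).1⟫ +
      t k * ‖(w k).1‖ ^ 2) atTop
      (𝓝 (2 * (α * ‖u‖ * ‖z₀.1 - a‖) + 2 * ⟪z₀.1 - a, q⟫ + 0 * ‖q‖ ^ 2)) :=
    ((((hw2.norm.const_mul α).mul_const _).const_mul 2).add
      ((tendsto_const_nhds.inner hw1).const_mul 2)).add (ht0.mul (hw1.norm.pow 2))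
  have h2 : 0 ≤ 2 * (α * ‖u‖ * ‖z₀.1 - a‖) + 2 * ⟪z₀.1 - a, q⟫ + 0 * ‖q‖ ^ 2 := by
    refine ge_of_tendsto' h1 fun k => ?_
    have h3 := hmin _ (hA k)
    simp only [Prod.fst_add, Prod.snd_add, Prod.smul_fst, Prod.smul_snd] at h3
    have htk := ht k
    have h4 : ‖z₀.2 + t k • (w k).2 - b‖ ≤ ‖z₀.2 - b‖ + t k * ‖(w k).2‖ := by
      rw [add_sub_right_comm]
      refine (norm_add_le _ _).trans ?_
      rw [norm_smul, Real.norm_of_nonneg htk.le]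
    have h5 := mul_le_mul_of_nonneg_left h4 hα
    have h6 : ‖z₀.1 + t k • (w k).1 - a‖ ^ 2 = ‖z₀.1 - a‖ ^ 2 + 2 * (t k * ⟪z₀.1 - a, (w k).1⟫) +
        (t k * ‖(w k).1‖) ^ 2 := by
      rw [add_sub_right_comm, norm_add_sq_real, real_inner_smul_right, norm_smul,
        Real.norm_of_nonneg htk.le]
    have hN := norm_nonneg (z₀.1 + t k • (w k).1 - a)
    have hN0 := norm_nonneg (z₀.1 - a)
    have hu : 0 ≤ α * ‖(w k).2‖ := by positivity
    set N := ‖z₀.1 + t k • (w k).1 - a‖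
    set N0 := ‖z₀.1 - a‖
    have h7 : N0 ^ 2 ≤ N ^ 2 + 2 * (t k * (α * ‖(w k).2‖)) * N0 := by
      have h8 : N0 ≤ N + t k * (α * ‖(w k).2‖) := by linarith
      have h9 : 0 ≤ t k * (α * ‖(w k).2‖) := by positivity
      nlinarith [sq_nonneg (N - N0)]
    refine nonneg_of_mul_nonneg_right (a := t k) ?_ htk
    nlinarith
  linarith

/-- The base point cannot frequently minimize `‖· - a k‖ + α k ‖· - b k‖` with `α k → 0` when the
tangent cone projects onto the whole space. -/
lemma not_frequently_min [ProperSpace P] {Γ : Set (P × X)} {z₀ : P × X}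
    (hsurj : ∀ q : P, ∃ u : X, (q, u) ∈ tcone Γ z₀) {a : ℕ → P} {b : ℕ → X} {α : ℕ → ℝ}
    (hα : ∀ k, 0 ≤ α k) (hα0 : Tendsto α atTop (𝓝 0)) :
    ¬ ∃ᶠ k in atTop, z₀.1 ≠ a k ∧ ∀ z ∈ Γ,
      ‖z₀.1 - a k‖ + α k * ‖z₀.2 - b k‖ ≤ ‖z.1 - a k‖ + α k * ‖z.2 - b k‖ := by
  intro hfreq
  obtain ⟨ns, hns, hns'⟩ := extraction_of_frequently_atTop hfreq
  set e : ℕ → P := fun k => ‖z₀.1 - a (ns k)‖⁻¹ • (z₀.1 - a (ns k)) with he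
  have hpos : ∀ k, 0 < ‖z₀.1 - a (ns k)‖ := fun k =>
    norm_pos_iff.2 (sub_ne_zero.2 (hns' k).1)
  have he1 : ∀ k, ‖e k‖ = 1 := fun k => by
    rw [he, norm_smul, norm_inv, norm_norm, inv_mul_cancel₀ (hpos k).ne']
  obtain ⟨e₀, -, ms, hms, hlim⟩ := (isCompact_closedBall (0 : P) 1).tendsto_subseq
    (x := e) fun k => by simp [he1 k]
  have he₀ : ‖e₀‖ = 1 :=
    tendsto_nhds_unique hlim.norm (by simp [he1])
  obtain ⟨u, hu⟩ := hsurj (-e₀)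
  have h1 : ∀ k, -(α (ns (ms k)) * ‖u‖) ≤ ⟪e (ms k), -e₀⟫ := fun k => by
    have h2 := neg_mul_norm_le_inner_of_min (hα _) (hns' (ms k)).2 hu
    rw [he, real_inner_smul_left, ← div_eq_inv_mul, le_div_iff₀ (hpos _)]
    linarith
  have h3 : Tendsto (fun k => -(α (ns (ms k)) * ‖u‖)) atTop (𝓝 (-(0 * ‖u‖))) :=
    ((hα0.comp (hns.tendsto_atTop.comp hms.tendsto_atTop)).mul_const _).neg
  have h4 : Tendsto (fun k => ⟪e (ms k), -e₀⟫) atTop (𝓝 ⟪e₀, -e₀⟫) :=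
    hlim.inner tendsto_const_nhds
  have h5 := le_of_tendsto_of_tendsto' h3 h4 h1
  rw [inner_neg_right, real_inner_self_eq_norm_sq, he₀] at h5
  linarith

/-- Limits of regular normals of the form `(p*, x*, v*)` with `p*` bounded away from zero and
`x* → 0`, taken at points approaching `z₀` along points `z k ≠ z₀`, give a nontrivial directional
normal. -/
lemma exists_directional_normal [ProperSpace P] [ProperSpace X] [ProperSpace Y]
    {A : Set (P × X × Y)} {z₀ : P × X} {z : ℕ → P × X} {y zs : ℕ → P × X × Y} {α r : ℕ → ℝ}
    {K : ℝ} (hα0 : Tendsto α atTop (𝓝 0)) (hr0 : Tendsto r atTop (𝓝 0))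
    (hz : ∀ k, z k ≠ z₀) (hz0 : Tendsto z atTop (𝓝 z₀))
    (hy : ∀ k, dist (y k) ((z k).1, (z k).2, 0) ≤ r k * dist (z k) z₀)
    (hzs : ∀ k, zs k ∈ rnc3 A (y k)) (h1 : ∀ k, 1 / 4 ≤ ‖(zs k).1‖) (h2 : ∀ k, ‖(zs k).1‖ ≤ 2)
    (h3 : ∀ k, ‖(zs k).2.1‖ ≤ α k) (h4 : ∀ k, ‖(zs k).2.2‖ ≤ K) :
    ∃ (q : P) (u : X) (qs : P) (vs : Y), (q, u) ≠ (0, 0) ∧ qs ≠ 0 ∧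
      (q, u, (0 : Y)) ∈ tcone A (z₀.1, z₀.2, (0 : Y)) ∧
      (qs, (0 : X), vs) ∈ dnc3 A (z₀.1, z₀.2, (0 : Y)) (q, u, (0 : Y)) := by
  set o : P × X × Y := (z₀.1, z₀.2, 0) with ho
  set t : ℕ → ℝ := fun k => dist (z k) z₀ with ht
  have htpos : ∀ k, 0 < t k := fun k => dist_pos.2 (hz k)
  have ht0 : Tendsto t atTop (𝓝 0) := tendsto_iff_dist_tendsto_zero.1 hz0
  set d : ℕ → P × X := fun k => (t k)⁻¹ • (z k - z₀) with hd
  have hd1 : ∀ k, ‖d k‖ = 1 := fun k => by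
    rw [hd, norm_smul, ← dist_eq_norm, norm_inv, Real.norm_of_nonneg (htpos k).le,
      inv_mul_cancel₀ (htpos k).ne']
  set w : ℕ → P × X × Y := fun k => (t k)⁻¹ • (y k - o) with hw
  have hdw : ∀ k, dist (w k) ((d k).1, (d k).2, 0) ≤ r k := fun k => by
    have e : ((d k).1, (d k).2, (0 : Y)) = (t k)⁻¹ • (((z k).1, (z k).2, (0 : Y)) - o) := by
      simp [hd, ho]
    rw [e, hw, dist_eq_norm, ← smul_sub, sub_sub_sub_cancel_right, norm_smul, ← dist_eq_norm,
      norm_inv, Real.norm_of_nonneg (htpos k).le, inv_mul_le_iff₀ (htpos k), mul_comm]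
    exact hy k
  have hwy : ∀ k, o + t k • w k = y k := fun k => by
    rw [hw, smul_inv_smul₀ (htpos k).ne', add_sub_cancel]
  have hzsX : Tendsto (fun k => (zs k).2.1) atTop (𝓝 0) := squeeze_zero_norm h3 hα0
  obtain ⟨⟨d₀, qs, vs⟩, -, ms, hms, hlim⟩ :=
    ((isCompact_closedBall (0 : P × X) 1).prod ((isCompact_closedBall (0 : P) 2).prod
      (isCompact_closedBall (0 : Y) K))).tendsto_subseq
      (x := fun k => (d k, (zs k).1, (zs k).2.2)) fun k => by
        simp [hd1 k, h2 k, h4 k]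
  have hms' := hms.tendsto_atTop
  have hdl : Tendsto (fun k => d (ms k)) atTop (𝓝 d₀) := (continuous_fst.tendsto _).comp hlim
  have hql : Tendsto (fun k => (zs (ms k)).1) atTop (𝓝 qs) :=
    ((continuous_fst.comp continuous_snd).tendsto _).comp hlim
  have hvl : Tendsto (fun k => (zs (ms k)).2.2) atTop (𝓝 vs) :=
    ((continuous_snd.comp continuous_snd).tendsto _).comp hlim
  have hd₀ : ‖d₀‖ = 1 := tendsto_nhds_unique hdl.norm (by simp [hd1])
  have hwl : Tendsto (fun k => w (ms k)) atTop (𝓝 (d₀.1, d₀.2, 0)) := by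
    have h5 : Tendsto (fun k => ((d (ms k)).1, (d (ms k)).2, (0 : Y))) atTop
        (𝓝 (d₀.1, d₀.2, 0)) :=
      ((continuous_fst.prodMk (continuous_snd.prodMk continuous_const)).tendsto d₀).comp hdl
    refine tendsto_of_tendsto_of_dist h5 ?_
    refine squeeze_zero (fun _ => dist_nonneg) (fun k => ?_) (hr0.comp hms')
    rw [dist_comm]
    exact hdw (ms k)
  have hzsl : Tendsto (fun k => zs (ms k)) atTop (𝓝 (qs, 0, vs)) :=
    hql.prodMk_nhds ((hzsX.comp hms').prodMk_nhds hvl)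
  refine ⟨d₀.1, d₀.2, qs, vs, ?_, ?_, ⟨fun k => t (ms k), fun k => w (ms k), fun k => htpos _,
    ht0.comp hms', hwl, fun k => ?_⟩, ⟨fun k => t (ms k), fun k => w (ms k), fun k => zs (ms k),
    fun k => htpos _, ht0.comp hms', hwl, hzsl, fun k => ?_⟩⟩
  · intro h0
    have : d₀ = 0 := h0
    simp [this] at hd₀
  · rintro rfl
    have := ge_of_tendsto' hql.norm fun k => h1 (ms k)
    rw [norm_zero] at this
    linarith
  · rw [hwy]
    exact (hzs _).1
  · rw [hwy]
    exact hzs _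

end Triple

/-- Exact penalization: a minimizer over the solution set of a subregular system minimizes the
penalized objective over the graph. -/
lemma le_add_mul_norm_of_subregular {P X Y : Type*} [NormedAddCommGroup P]
    [NormedAddCommGroup X] [NormedAddCommGroup Y] {M : P × X → Set Y} {z₀ ζ₀ : P × X} {κ ε : ℝ}
    (hsub : ∀ z, dist z z₀ < ε → ∀ v ∈ M z, ∀ η > 0,
      ∃ ζ, (0 : Y) ∈ M ζ ∧ dist z ζ < κ * ‖v‖ + η)
    {a : P} {b : X} {α : ℝ} (hα : 0 ≤ α) (hα1 : α ≤ 1)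
    (hmin : ∀ y, (0 : Y) ∈ M y →
      ‖ζ₀.1 - a‖ + α * ‖ζ₀.2 - b‖ ≤ ‖y.1 - a‖ + α * ‖y.2 - b‖)
    {z : P × X × Y} (hz : z ∈ gph3 M) (hdist : dist (z.1, z.2.1) z₀ < ε) :
    ‖ζ₀.1 - a‖ + α * ‖ζ₀.2 - b‖ ≤ ‖z.1 - a‖ + α * ‖z.2.1 - b‖ + 2 * κ * ‖z.2.2‖ := by
  refine le_of_forall_pos_le_add fun η hη => ?_
  obtain ⟨ζ, hζ, hd⟩ := hsub _ hdist _ hz (η / 2) (by positivity)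
  have h1 := hmin ζ hζ
  obtain ⟨h2, h3⟩ := max_lt_iff.1 (Prod.dist_eq.symm.trans_lt hd)
  simp only [← dist_eq_norm] at h1 h2 h3 ⊢
  have h4 : dist ζ.2 b ≤ dist z.2.1 b + dist z.2.1 ζ.2 := by
    linarith [dist_triangle_left ζ.2 b z.2.1]
  have h5 : dist ζ.1 a ≤ dist z.1 a + dist z.1 ζ.1 := by
    linarith [dist_triangle_left ζ.1 a z.1]
  have h6 := mul_le_mul_of_nonneg_left h4 hα
  have h7 : α * dist z.2.1 ζ.2 ≤ dist z.2.1 ζ.2 := mul_le_of_le_one_left dist_nonneg hα1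
  linarith

/-- If the linear-rate openness estimate with modulus `α⁻¹` fails near `z₀`, then a point of `Γ`
near `z₀` minimizes `‖· - a‖ + α ‖· - b‖` over `Γ` without lying over `a`. -/
lemma exists_minimizer_of_not_lipschitzLike {P X : Type*} [NormedAddCommGroup P]
    [NormedAddCommGroup X] [ProperSpace P] [ProperSpace X] {Γ : Set (P × X)} (hΓ : IsClosed Γ)
    {z₀ : P × X} {α : ℝ} (hα : 0 < α) (hα1 : α ≤ 1)
    (h : ∃ p p' x, dist p z₀.1 < α ^ 2 ∧ dist p' z₀.1 < α ^ 2 ∧ dist x z₀.2 < α ^ 2 ∧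
      (p', x) ∈ Γ ∧ ∀ x', (p, x') ∈ Γ → dist p' p < α * dist x' x) :
    ∃ a b, ∃ z ∈ Γ, z.1 ≠ a ∧ dist z z₀ ≤ 3 * α ∧
      ∀ y ∈ Γ, ‖z.1 - a‖ + α * ‖z.2 - b‖ ≤ ‖y.1 - a‖ + α * ‖y.2 - b‖ := by
  obtain ⟨p, p', x, hp, hp', hx, hmem, hfail⟩ := h
  set f : P × X → ℝ := fun y => ‖y.1 - p‖ + α * ‖y.2 - x‖ with hf
  have hcont : Continuous f := by fun_prop
  have hcoer : Tendsto f (cocompact (P × X)) atTop := by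
    have h1 : Tendsto (fun y : P × X => α * ‖y - (p, x)‖) (cocompact _) atTop := by
      refine Tendsto.const_mul_atTop hα ?_
      simpa [dist_eq_norm] using tendsto_dist_right_cocompact_atTop (p, x)
    refine tendsto_atTop_mono (fun y => ?_) h1
    rw [Prod.norm_def, mul_max_of_nonneg _ _ hα.le]
    simp only [hf, Prod.fst_sub, Prod.snd_sub]
    refine max_le ?_ ?_
    · nlinarith [norm_nonneg (y.1 - p), norm_nonneg (y.2 - x)]
    · linarith [norm_nonneg (y.1 - p)]
  obtain ⟨z, hz, hmin⟩ := hcont.continuousOn.exists_isMinOn' hΓ hmem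
    ((hcoer.eventually_ge_atTop _).filter_mono inf_le_left)
  have hmin' : ∀ y ∈ Γ, f z ≤ f y := fun y hy => hmin hy
  have h0 : f z ≤ dist p' p := by simpa [hf, dist_eq_norm] using hmin' _ hmem
  have hpp : dist p' p < 2 * α ^ 2 := by
    linarith [dist_triangle_right p' p z₀.1]
  simp only [hf, ← dist_eq_norm] at h0
  refine ⟨p, x, z, hz, ?_, ?_, hmin'⟩
  · intro hzp
    have h1 := hfail z.2 (by rw [← hzp]; exact hz)
    linarith [dist_nonneg (x := z.1) (y := p)]
  · have hαα : α ^ 2 ≤ α := by nlinarith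
    have h2 : dist z.2 x ≤ 2 * α := by
      refine le_of_mul_le_mul_left ?_ hα
      nlinarith [dist_nonneg (x := z.1) (y := p)]
    have h3 : dist z.1 p ≤ 2 * α := by
      nlinarith [dist_nonneg (x := z.2) (y := x)]
    rw [Prod.dist_eq]
    exact max_le (by linarith [dist_triangle z.1 p z₀.1]) (by linarith [dist_triangle z.2 x z₀.2])


lemma aubinAround_of_local {P X : Type*} [MetricSpace P] [MetricSpace X] {F : P → Set X} {pb : P}
    {xb : X} (hmem : xb ∈ F pb) {α ε : ℝ} (hα : 0 < α) (hε : 0 < ε)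
    (h : ∀ p p' x, dist p pb < ε → dist p' pb < ε → dist x xb < ε → x ∈ F p' →
      ∃ x' ∈ F p, α * dist x' x ≤ dist p' p) : AubinAround F pb xb := by
  have key : ∀ p p' x, dist p pb < ε / 2 → dist x xb < ε / 2 → x ∈ F p' →
      ∃ x' ∈ F p, dist x x' ≤ (1 + α⁻¹) * dist p' p := by
    intro p p' x hp hx hxF
    by_cases hp' : dist p' pb < ε
    · obtain ⟨x', hx', hd⟩ := h p p' x (by linarith) hp' (by linarith) hxF
      refine ⟨x', hx', ?_⟩
      rw [mul_comm, ← le_div_iff₀ hα, div_eq_inv_mul, dist_comm] at hd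
      linarith [dist_nonneg (x := p') (y := p)]
    · obtain ⟨x', hx', hd⟩ := h p pb xb (by linarith) (by simpa) (by simpa) hmem
      refine ⟨x', hx', ?_⟩
      rw [mul_comm, ← le_div_iff₀ hα, div_eq_inv_mul, dist_comm, dist_comm pb] at hd
      have h1 : ε / 2 ≤ dist p' p := by linarith [dist_triangle p' p pb]
      have h2 : α⁻¹ * dist p pb ≤ α⁻¹ * dist p' p := by gcongr; linarith
      linarith [dist_triangle x xb x']
  refine ⟨1 + α⁻¹, by positivity, ε / 2, by positivity, fun p p' x hp hx hxF => ?_⟩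
  obtain ⟨x', hx', hd⟩ := key p p' x hp hx hxF
  refine (Metric.infEDist_le_edist_of_mem hx').trans ?_
  rw [edist_dist]
  exact ENNReal.ofReal_le_ofReal hd

/-- Main criterion for the Aubin property of the implicit multifunction `S`, together
with the formula for its graphical derivative (Theorem `ThAubinImplMultFunc`). -/
theorem stmt18 {l n m : ℕ} (M : Es l × Es n → Set (Es m)) (pb : Es l) (xb : Es n)
    (hcl : IsClosed (gph3 M)) (hbar : (0 : Es m) ∈ M (pb, xb))
    (ha : ∀ q : Es l, ∃ u : Es n,
      (q, u, (0 : Es m)) ∈ tcone (gph3 M) (pb, xb, (0 : Es m)))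
    (hb : ∃ κ : ℝ, 0 ≤ κ ∧ ∃ ε : ℝ, 0 < ε ∧ ∀ z : Es l × Es n, dist z (pb, xb) < ε →
      EMetric.infEdist z {z' : Es l × Es n | (0 : Es m) ∈ M z'} ≤
        ENNReal.ofReal κ * EMetric.infEdist (0 : Es m) (M z))
    (hc : ∀ (q : Es l) (u : Es n), (q, u) ≠ (0, 0) →
      (q, u, (0 : Es m)) ∈ tcone (gph3 M) (pb, xb, (0 : Es m)) →
      ∀ (qs : Es l) (vs : Es m),
        (qs, (0 : Es n), -vs) ∈ dnc3 (gph3 M) (pb, xb, (0 : Es m)) (q, u, (0 : Es m)) →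
        qs = 0) :
    AubinAround (fun p => {x | (0 : Es m) ∈ M (p, x)}) pb xb ∧
    ∀ q : Es l, {u : Es n | (q, u) ∈ tcone {z : Es l × Es n | (0 : Es m) ∈ M z} (pb, xb)} =
      {u : Es n | (q, u, (0 : Es m)) ∈ tcone (gph3 M) (pb, xb, (0 : Es m))} := by
  obtain ⟨κ, hκ, ε, hε, hb⟩ := hb
  have hsub : ∀ z, dist z (pb, xb) < ε → ∀ v ∈ M z, ∀ η > 0,
      ∃ ζ, (0 : Es m) ∈ M ζ ∧ dist z ζ < κ * ‖v‖ + η := by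
    intro z hz v hv η hη
    have h1 : Metric.infEDist z {z' : Es l × Es n | (0 : Es m) ∈ M z'} <
        ENNReal.ofReal (κ * ‖v‖ + η) := by
      refine (hb z hz).trans_lt ?_
      calc ENNReal.ofReal κ * Metric.infEDist (0 : Es m) (M z)
          ≤ ENNReal.ofReal κ * edist 0 v := by
            gcongr
            exact Metric.infEDist_le_edist_of_mem hv
        _ = ENNReal.ofReal (κ * ‖v‖) := by
            rw [edist_dist, dist_zero_left, ENNReal.ofReal_mul hκ]
        _ < _ := (ENNReal.ofReal_lt_ofReal_iff (by positivity)).2 (by linarith)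
    obtain ⟨ζ, hζ, hlt⟩ := Metric.infEDist_lt_iff.1 h1
    refine ⟨ζ, hζ, ?_⟩
    rw [edist_dist] at hlt
    exact (ENNReal.ofReal_lt_ofReal_iff (by positivity)).1 hlt
  have htan : ∀ q u, (q, u) ∈ tcone {z : Es l × Es n | (0 : Es m) ∈ M z} (pb, xb) ↔
      (q, u, (0 : Es m)) ∈ tcone (gph3 M) (pb, xb, (0 : Es m)) := fun q u =>
    ⟨fun h => tcone_fst_subset h, fun h => fst_mem_tcone_of_subregular hε hsub h⟩
  refine ⟨?_, fun q => Set.ext fun u => htan q u⟩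
  have hΓ : IsClosed {z : Es l × Es n | (0 : Es m) ∈ M z} :=
    hcl.preimage (f := fun z : Es l × Es n => (z.1, z.2, (0 : Es m))) (by fun_prop)
  by_contra hnot
  obtain ⟨c, hc0, hc1, hcε⟩ : ∃ c : ℝ, 0 < c ∧ c ≤ 1 ∧ 3 * c ≤ ε / 2 :=
    ⟨min 1 (ε / 6), by positivity, min_le_left _ _, by linarith [min_le_right 1 (ε / 6)]⟩
  set α : ℕ → ℝ := fun k => c * (1 / ((k : ℝ) + 1)) with hα
  have hαpos : ∀ k, 0 < α k := fun k => by positivity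
  have hαc : ∀ k, α k ≤ c := fun k => by
    refine mul_le_of_le_one_right hc0.le ?_
    rw [div_le_one (by positivity)]
    linarith [Nat.cast_nonneg (α := ℝ) k]
  have hα1 : ∀ k, α k ≤ 1 := fun k => (hαc k).trans hc1
  have hα0 : Tendsto α atTop (𝓝 0) := by
    simpa [hα] using (tendsto_one_div_add_atTop_nhds_zero_nat (𝕜 := ℝ)).const_mul c
  have hex : ∀ k, ∃ a b, ∃ z ∈ {z : Es l × Es n | (0 : Es m) ∈ M z}, z.1 ≠ a ∧
      dist z (pb, xb) ≤ 3 * α k ∧ ∀ y ∈ {z : Es l × Es n | (0 : Es m) ∈ M z},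
      ‖z.1 - a‖ + α k * ‖z.2 - b‖ ≤ ‖y.1 - a‖ + α k * ‖y.2 - b‖ := by
    intro k
    refine exists_minimizer_of_not_lipschitzLike hΓ (hαpos k) (hα1 k) ?_
    by_contra! hcon
    refine hnot (aubinAround_of_local hbar (hαpos k) (pow_pos (hαpos k) 2) ?_)
    exact fun p p' x hp hp' hx hmem => hcon p p' x hp hp' hx hmem
  choose a b z hzΓ hza hzd hzmin using hex
  have hnear : ∀ᶠ k in atTop, z k ≠ (pb, xb) := by
    have h := not_frequently_min (Γ := {z : Es l × Es n | (0 : Es m) ∈ M z}) (z₀ := (pb, xb))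
      (fun q => (ha q).imp fun u hu => (htan q u).2 hu) (a := a) (b := b)
      (fun k => (hαpos k).le) hα0
    refine (not_frequently.1 h).mono fun k hk hzk => hk ?_
    rw [← hzk]
    exact ⟨hza k, hzmin k⟩
  obtain ⟨N, hN⟩ := eventually_atTop.1 hnear
  have hz0 : Tendsto z atTop (𝓝 (pb, xb)) := tendsto_iff_dist_tendsto_zero.2 <|
    squeeze_zero (fun _ => dist_nonneg) hzd (by simpa using hα0.const_mul 3)
  have hnormal : ∀ k, ∃ y, dist y ((z (k + N)).1, (z (k + N)).2, (0 : Es m)) <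
      α (k + N) * min 1 (dist (z (k + N)) (pb, xb)) ∧ ∃ zs ∈ rnc3 (gph3 M) y,
      1 / 4 ≤ ‖zs.1‖ ∧ ‖zs.1‖ ≤ 2 ∧
      ‖zs.2.1‖ ≤ α (k + N) + α (k + N) * min 1 (dist (z (k + N)) (pb, xb)) ∧
      ‖zs.2.2‖ ≤ 2 * κ + α (k + N) * min 1 (dist (z (k + N)) (pb, xb)) := by
    intro k
    have hpos : 0 < dist (z (k + N)) (pb, xb) := dist_pos.2 (hN _ (Nat.le_add_left _ _))
    refine exists_rnc3_of_local_min_norms hcl (a := a (k + N)) (b := b (k + N)) (ρ := ε / 2)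
      (hzΓ (k + N)) (hza _) (hαpos _).le (by positivity) (by positivity) ?_
      (mul_pos (hαpos _) (by positivity))
    intro y hy hyd
    refine le_add_mul_norm_of_subregular hsub (hαpos _).le (hα1 _) (hzmin (k + N)) hy ?_
    have h1 : dist (y.1, y.2.1) (z (k + N)) < ε / 2 := by
      refine lt_of_le_of_lt ?_ hyd
      rw [Prod.dist_eq, Prod.dist_eq, Prod.dist_eq]
      exact max_le_max le_rfl (le_max_left _ _)
    linarith [dist_triangle (y.1, y.2.1) (z (k + N)) (pb, xb), hzd (k + N), hαc (k + N)]
  choose y hyd zs hzs hzs1 hzs2 hzs3 hzs4 using hnormal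
  have hmin1 : ∀ k, α (k + N) * min 1 (dist (z (k + N)) (pb, xb)) ≤ α (k + N) := fun k =>
    mul_le_of_le_one_right (hαpos _).le (min_le_left _ _)
  have hshift : Tendsto (fun k => k + N) atTop atTop := tendsto_add_atTop_nat N
  obtain ⟨q, u, qs, vs, hqu, hqs, ht, hn⟩ := exists_directional_normal (A := gph3 M)
    (z₀ := (pb, xb)) (z := fun k => z (k + N)) (y := y) (zs := zs)
    (α := fun k => 2 * α (k + N)) (r := fun k => α (k + N)) (K := 2 * κ + 1)
    (by simpa using (hα0.comp hshift).const_mul 2) (hα0.comp hshift)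
    (fun k => hN _ (Nat.le_add_left _ _)) (hz0.comp hshift)
    (fun k => (hyd k).le.trans (mul_le_mul_of_nonneg_left (min_le_right _ _) (hαpos _).le))
    hzs hzs1 hzs2 (fun k => by linarith [hzs3 k, hmin1 k])
    (fun k => by linarith [hzs4 k, hmin1 k, hα1 (k + N)])
  exact hqs (hc q u hqu ht qs (-vs) (by rwa [neg_neg]))
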